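/- arXiv:q-alg/9705017 — 2 statements merged into one kernel-verified Lean document; each statement's English description precedes it below -/
import Mathlib

section
/- Let τ, p ∈ ℂ with Im τ > 0 and Im p > 0, let a ∈ ℂ, and set Φ_a(t) = e^{−2πiat/p} Ω_a(t). Then Φ_a is a phase function: for every t ∈ ℂ at which both products Ω_a(t) and Ω_a(t+p) are defined (no denominator factor vanishes) and θ(t−a,τ) ≠ 0, one has Φ_a(t+p) = (θ(t+a,τ)/θ(t−a,τ)) · Φ_a(t). -/
open Complex

/-- The first Jacobi theta function
`θ(t,τ) = −∑_{j∈ℤ} exp(πi(j+1/2)²τ + 2πi(j+1/2)(t+1/2))`. -/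
noncomputable def jacobiTheta1 (t τ : ℂ) : ℂ :=
  -∑' j : ℤ, Complex.exp (Real.pi * I * (j + 1/2) ^ 2 * τ +
    2 * Real.pi * I * (j + 1/2) * (t + 1/2))

/-- The convergent double product
`Ω_a(t,τ,p) = ∏_{j,k≥0} [(1−r^j q^k e^{2πi(t−a)})(1−r^{j+1}q^{k+1}e^{−2πi(t+a)})] /
[(1−r^j q^k e^{2πi(t+a)})(1−r^{j+1}q^{k+1}e^{−2πi(t−a)})]`, with `q = e^{2πiτ}`,
`r = e^{2πip}`. -/
noncomputable def OmegaFn (a t τ p : ℂ) : ℂ :=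
  ∏' jk : ℕ × ℕ,
    (((1 - Complex.exp (2 * Real.pi * I * p) ^ jk.1 * Complex.exp (2 * Real.pi * I * τ) ^ jk.2 *
          Complex.exp (2 * Real.pi * I * (t - a))) *
      (1 - Complex.exp (2 * Real.pi * I * p) ^ (jk.1 + 1) *
          Complex.exp (2 * Real.pi * I * τ) ^ (jk.2 + 1) *
          Complex.exp (-(2 * Real.pi * I * (t + a))))) /
     ((1 - Complex.exp (2 * Real.pi * I * p) ^ jk.1 * Complex.exp (2 * Real.pi * I * τ) ^ jk.2 *
          Complex.exp (2 * Real.pi * I * (t + a))) *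
      (1 - Complex.exp (2 * Real.pi * I * p) ^ (jk.1 + 1) *
          Complex.exp (2 * Real.pi * I * τ) ^ (jk.2 + 1) *
          Complex.exp (-(2 * Real.pi * I * (t - a))))))

/-- None of the factors of `Ω_a` (numerators and denominators) vanishes at `t`. -/
def OmegaDefined (a t τ p : ℂ) : Prop :=
  ∀ j k : ℕ,
    (1 - Complex.exp (2 * Real.pi * I * p) ^ j * Complex.exp (2 * Real.pi * I * τ) ^ k *
        Complex.exp (2 * Real.pi * I * (t + a))) ≠ 0 ∧
    (1 - Complex.exp (2 * Real.pi * I * p) ^ (j + 1) *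
        Complex.exp (2 * Real.pi * I * τ) ^ (k + 1) *
        Complex.exp (-(2 * Real.pi * I * (t - a)))) ≠ 0

noncomputable def qfac (q : ℂ) (n : ℕ) : ℂ := ∏ k ∈ Finset.range n, (1 - q ^ (k + 1))

noncomputable def qrec (q : ℂ) (m : ℤ) : ℂ := if 0 ≤ m then (qfac q m.toNat)⁻¹ else 0

lemma one_sub_pow_ne {q : ℂ} (hq : ‖q‖ < 1) (k : ℕ) : (1 - q ^ (k + 1)) ≠ 0 := by
  intro h
  have h1 : ‖q ^ (k + 1)‖ = 1 := by rw [← sub_eq_zero.mp h]; simp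
  rw [norm_pow] at h1
  have := pow_lt_one₀ (norm_nonneg q) hq (Nat.succ_ne_zero k)
  exact this.ne h1

lemma qfac_ne {q : ℂ} (hq : ‖q‖ < 1) (n : ℕ) : qfac q n ≠ 0 :=
  Finset.prod_ne_zero_iff.mpr fun k _ => one_sub_pow_ne hq k

lemma qrec_sub_one {q : ℂ} (hq : ‖q‖ < 1) (m : ℤ) :
    qrec q (m - 1) = (1 - q ^ m) * qrec q m := by
  unfold qrec
  rcases lt_trichotomy m 0 with h | h | h
  · rw [if_neg (by omega), if_neg (by omega)]; simp
  · subst h; simp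
  · rw [if_pos (by omega), if_pos (by omega)]
    obtain ⟨k, rfl⟩ : ∃ k : ℕ, m = k + 1 := ⟨(m - 1).toNat, by omega⟩
    have h1 : ((k : ℤ) + 1 - 1).toNat = k := by omega
    have h2 : ((k : ℤ) + 1).toNat = k + 1 := by omega
    have h3 : qfac q (k + 1) = qfac q k * (1 - q ^ (k + 1)) := Finset.prod_range_succ _ _
    rw [h1, h2, h3]
    have h4 := one_sub_pow_ne hq k
    have h5 := qfac_ne hq k
    have h6 : q ^ ((k : ℤ) + 1) = q ^ (k + 1) := by exact_mod_cast zpow_natCast q (k + 1)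
    rw [h6]
    field_simp

noncomputable def jcoef (q : ℂ) (n : ℕ) (m : ℤ) : ℂ :=
  qfac q (2 * n) * qrec q (n - m) * qrec q (n + m)

lemma jcoef_succ {q : ℂ} (hq0 : q ≠ 0) (hq : ‖q‖ < 1) (n : ℕ) (m : ℤ) :
    jcoef q (n + 1) m = (1 + q ^ (2 * n + 1)) * jcoef q n m
      + q ^ n * q ^ (1 - m) * jcoef q n (m - 1) + q ^ (n + 1) * q ^ m * jcoef q n (m + 1) := by
  unfold jcoef
  have hQ : qfac q (2 * (n + 1)) = qfac q (2 * n) * (1 - q ^ (2 * n + 1)) * (1 - q ^ (2 * n + 2)) := by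
    unfold qfac
    rw [show 2 * (n + 1) = 2 * n + 1 + 1 by ring, Finset.prod_range_succ, Finset.prod_range_succ]
  push_cast
  set u := qrec q ((n : ℤ) + 1 - m) with hu
  set v := qrec q ((n : ℤ) + 1 + m) with hv
  have e1 : qrec q ((n : ℤ) - m) = (1 - q ^ ((n : ℤ) + 1 - m)) * u := by
    rw [hu, ← qrec_sub_one hq]; congr 1; ring
  have e2 : qrec q ((n : ℤ) + m) = (1 - q ^ ((n : ℤ) + 1 + m)) * v := by
    rw [hv, ← qrec_sub_one hq]; congr 1; ring
  have e3 : qrec q ((n : ℤ) - (m - 1)) = u := by rw [hu]; congr 1; ring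
  have e4 : qrec q ((n : ℤ) + (m - 1)) = (1 - q ^ ((n : ℤ) + m)) * ((1 - q ^ ((n : ℤ) + 1 + m)) * v) := by
    rw [← e2, ← qrec_sub_one hq]; congr 1; ring
  have e5 : qrec q ((n : ℤ) + (m + 1)) = v := by rw [hv]; congr 1; ring
  have e6 : qrec q ((n : ℤ) - (m + 1)) = (1 - q ^ ((n : ℤ) - m)) * ((1 - q ^ ((n : ℤ) + 1 - m)) * u) := by
    rw [← e1, ← qrec_sub_one hq]; congr 1; ring
  rw [e1, e2, e3, e4, e5, e6, hQ]
  have hJ : q ^ m ≠ 0 := zpow_ne_zero _ hq0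
  simp only [zpow_add₀ hq0, zpow_sub₀ hq0, zpow_natCast, zpow_one]
  simp only [pow_add, pow_mul', pow_one]
  generalize q ^ m = J at *
  generalize q ^ n = N at *
  field_simp
  ring

lemma finite_jtp {q x : ℂ} (hq0 : q ≠ 0) (hq : ‖q‖ < 1) (hx : x ≠ 0) (T : ℤ → ℂ)
    (hT : ∀ m, T (m + 1) = -(q ^ m * x * T m)) (n : ℕ) :
    HasSum (fun m => jcoef q n m * T m)
      (T 0 * ∏ k ∈ Finset.range n, ((1 - q ^ k * x) * (1 - q ^ (k + 1) * x⁻¹))) := by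
  induction n with
  | zero =>
    have := hasSum_single (f := fun m => jcoef q 0 m * T m) 0 (by
      intro m hm
      rcases lt_or_gt_of_ne hm with h | h
      · simp [jcoef, qrec, h]
      · simp [jcoef, qrec, h])
    simpa [jcoef, qrec, qfac] using this
  | succ n ih =>
    have s1 := (Equiv.addRight (1 : ℤ)).hasSum_iff.mpr ih
    have s2 := (Equiv.addRight (-1 : ℤ)).hasSum_iff.mpr ih
    have := ((ih.mul_left (1 + q ^ (2 * n + 1))).add (s2.mul_left (-(q ^ n * x)))).add
      (s1.mul_left (-(q ^ (n + 1) * x⁻¹)))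
    convert this using 1
    · rfl
    · funext m
      simp only [Function.comp, Equiv.coe_addRight]
      have t1 := hT m
      have t2 := hT (m - 1)
      rw [sub_add_cancel] at t2
      rw [jcoef_succ hq0 hq, t1, ← sub_eq_add_neg]
      have hz : q ^ (1 - m) * q ^ (m - 1) = 1 := by
        rw [← zpow_add₀ hq0]; simp
      have t3 : x * T (m - 1) = -(q ^ (1 - m) * T m) := by
        rw [t2]; linear_combination (-(x * T (m - 1))) * hz
      have t4 : x⁻¹ * x = 1 := inv_mul_cancel₀ hx
      linear_combination (q ^ n * jcoef q n (m - 1)) * t3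
        - (q ^ (n + 1) * jcoef q n (m + 1) * q ^ m * T m) * t4
    · rw [Finset.prod_range_succ]
      have t4 : x⁻¹ * x = 1 := inv_mul_cancel₀ hx
      generalize (∏ k ∈ Finset.range n, ((1 - q ^ k * x) * (1 - q ^ (k + 1) * x⁻¹))) = F
      linear_combination (T 0 * F * q ^ (2 * n + 1)) * t4

lemma summable_qpow {q : ℂ} (hq : ‖q‖ < 1) (x : ℂ) : Summable fun k : ℕ => ‖-(q ^ k * x)‖ := by
  simp only [norm_neg, norm_mul, norm_pow]
  exact (summable_geometric_of_lt_one (norm_nonneg q) hq).mul_right _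

lemma mult_P {q : ℂ} (hq : ‖q‖ < 1) (x : ℂ) : Multipliable fun k : ℕ => (1 - q ^ k * x) := by
  simpa [sub_eq_add_neg] using multipliable_one_add_of_summable (summable_qpow hq x)

lemma qfac_tendsto {q : ℂ} (hq : ‖q‖ < 1) :
    ∃ L : ℂ, L ≠ 0 ∧ Filter.Tendsto (qfac q) Filter.atTop (nhds L) := by
  refine ⟨∏' k : ℕ, (1 - q ^ k * q), ?_, ?_⟩
  · have := tprod_one_add_ne_zero_of_summable (f := fun k : ℕ => -(q ^ k * q)) (by
      intro k
      have := one_sub_pow_ne hq k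
      rwa [pow_succ, sub_eq_add_neg] at this) (summable_qpow hq q)
    simpa [sub_eq_add_neg] using this
  · have := (mult_P hq q).tendsto_prod_tprod_nat
    simp only [← pow_succ] at this
    simp only [← pow_succ]
    exact this

/-- Jacobi triple product, up to the constant. -/
lemma jtp {q x : ℂ} (hq0 : q ≠ 0) (hq : ‖q‖ < 1) (hx : x ≠ 0) {L : ℂ} (hL0 : L ≠ 0)
    (hL : Filter.Tendsto (qfac q) Filter.atTop (nhds L)) (T : ℤ → ℂ)
    (hT : ∀ m, T (m + 1) = -(q ^ m * x * T m)) (hs : Summable T) :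
    ∑' m, T m = L * (T 0 * ((∏' k : ℕ, (1 - q ^ k * x)) * ∏' k : ℕ, (1 - q ^ k * (q * x⁻¹)))) := by
  have hlim1 : Filter.Tendsto (fun n => T 0 * ∏ k ∈ Finset.range n,
      ((1 - q ^ k * x) * (1 - q ^ (k + 1) * x⁻¹))) Filter.atTop
      (nhds (T 0 * ((∏' k : ℕ, (1 - q ^ k * x)) * ∏' k : ℕ, (1 - q ^ k * (q * x⁻¹))))) := by
    refine Filter.Tendsto.const_mul _ ?_
    have := ((mult_P hq x).tendsto_prod_tprod_nat).mul
      ((mult_P hq (q * x⁻¹)).tendsto_prod_tprod_nat)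
    simpa only [Finset.prod_mul_distrib, pow_succ, mul_assoc] using this
  have hLi : Filter.Tendsto (fun n => (qfac q n)⁻¹) Filter.atTop (nhds L⁻¹) := hL.inv₀ hL0
  obtain ⟨A, hA⟩ := (Metric.isBounded_range_of_tendsto _ hL).exists_norm_le
  obtain ⟨B, hB⟩ := (Metric.isBounded_range_of_tendsto _ hLi).exists_norm_le
  have hA' : ∀ n, ‖qfac q n‖ ≤ A := fun n => hA _ ⟨n, rfl⟩
  have hB' : ∀ n, ‖(qfac q n)⁻¹‖ ≤ B := fun n => hB _ ⟨n, rfl⟩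
  have hA0 : 0 ≤ A := (norm_nonneg _).trans (hA' 0)
  have hB0 : 0 ≤ B := (norm_nonneg _).trans (hB' 0)
  have hR : ∀ m, ‖qrec q m‖ ≤ B := by
    intro m
    unfold qrec
    split_ifs
    · exact hB' _
    · simpa using hB0
  have hRl : ∀ m : ℤ, Filter.Tendsto (fun n : ℕ => qrec q (n + m)) Filter.atTop (nhds L⁻¹) := by
    intro m
    have h1 : Filter.Tendsto (fun n : ℕ => ((n : ℤ) + m).toNat) Filter.atTop Filter.atTop := by
      rw [Filter.tendsto_atTop]
      intro b
      filter_upwards [Filter.eventually_ge_atTop (b + m.natAbs)] with n hn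
      omega
    refine (hLi.comp h1).congr' ?_
    filter_upwards [Filter.eventually_ge_atTop m.natAbs] with n hn
    simp only [Function.comp, qrec]
    rw [if_pos (by omega)]
  have hlim2 : Filter.Tendsto (fun n => ∑' m, jcoef q n m * T m) Filter.atTop
      (nhds (∑' m, L⁻¹ * T m)) := by
    refine tendsto_tsum_of_dominated_convergence (bound := fun m => A * B * B * ‖T m‖)
      (hs.norm.mul_left _) ?_ ?_
    · intro m
      refine Filter.Tendsto.mul_const _ ?_
      have h2 : Filter.Tendsto (fun n : ℕ => 2 * n) Filter.atTop Filter.atTop :=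
        Filter.tendsto_id.const_mul_atTop' (by norm_num)
      have := ((hL.comp h2).mul (hRl (-m))).mul (hRl m)
      rw [mul_inv_cancel₀ hL0, one_mul] at this
      exact this
    · refine Filter.Eventually.of_forall fun n m => ?_
      rw [norm_mul]
      unfold jcoef
      rw [norm_mul, norm_mul]
      gcongr
      · exact hA' _
      · exact hR _
      · exact hR _
  have heq := tendsto_nhds_unique hlim1
    (hlim2.congr fun n => (finite_jtp hq0 hq hx T hT n).tsum_eq)
  rw [heq, tsum_mul_left, ← mul_assoc, mul_inv_cancel₀ hL0, one_mul]

noncomputable def dprod (r q c : ℂ) : ℂ := ∏' jk : ℕ × ℕ, (1 - r ^ jk.1 * q ^ jk.2 * c)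

lemma summable_rq {r q : ℂ} (hr : ‖r‖ < 1) (hq : ‖q‖ < 1) (c : ℂ) :
    Summable fun jk : ℕ × ℕ => ‖-(r ^ jk.1 * q ^ jk.2 * c)‖ := by
  simp only [norm_neg, norm_mul, norm_pow]
  exact ((summable_geometric_of_lt_one (norm_nonneg r) hr).mul_of_nonneg
    (summable_geometric_of_lt_one (norm_nonneg q) hq) (fun _ => by positivity)
    (fun _ => by positivity)).mul_right _

lemma hasProd_dprod {r q : ℂ} (hr : ‖r‖ < 1) (hq : ‖q‖ < 1) (c : ℂ) :
    HasProd (fun jk : ℕ × ℕ => (1 - r ^ jk.1 * q ^ jk.2 * c)) (dprod r q c) := by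
  have := multipliable_one_add_of_summable (summable_rq hr hq c)
  simp only [← sub_eq_add_neg] at this
  exact this.hasProd

lemma dprod_ne {r q : ℂ} (hr : ‖r‖ < 1) (hq : ‖q‖ < 1) (c : ℂ)
    (h : ∀ j k : ℕ, 1 - r ^ j * q ^ k * c ≠ 0) : dprod r q c ≠ 0 := by
  have := tprod_one_add_ne_zero_of_summable (f := fun jk : ℕ × ℕ => -(r ^ jk.1 * q ^ jk.2 * c))
    (by intro jk; rw [← sub_eq_add_neg]; exact h _ _) (summable_rq hr hq c)
  simp only [← sub_eq_add_neg] at this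
  exact this

lemma dprod_step {r q : ℂ} (hr : ‖r‖ < 1) (hq : ‖q‖ < 1) (c : ℂ) :
    dprod r q c = (∏' k : ℕ, (1 - q ^ k * c)) * dprod r q (r * c) := by
  have h1 := (hasProd_dprod hr hq c).prod_fiberwise
    (g := fun j => ∏' k : ℕ, (1 - q ^ k * (r ^ j * c))) (fun j => by
      have := (mult_P hq (r ^ j * c)).hasProd
      convert this using 2
      ring)
  have h2 := (hasProd_dprod hr hq (r * c)).prod_fiberwise
    (g := fun j => ∏' k : ℕ, (1 - q ^ k * (r ^ (j + 1) * c))) (fun j => by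
      have := (mult_P hq (r ^ (j + 1) * c)).hasProd
      convert this using 2
      ring)
  have h3 := HasProd.zero_mul (f := fun j => ∏' k : ℕ, (1 - q ^ k * (r ^ j * c))) h2
  have := h1.unique h3
  simpa using this

lemma norm_exp_lt {τ : ℂ} (hτ : 0 < τ.im) : ‖Complex.exp (2 * Real.pi * I * τ)‖ < 1 := by
  rw [Complex.norm_exp, Real.exp_lt_one_iff]
  have : (2 * Real.pi * I * τ).re = -(2 * Real.pi * τ.im) := by simp
  rw [this]
  have := Real.pi_pos
  have : 0 < 2 * Real.pi * τ.im := by positivity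
  linarith

lemma omega_eq (τ p a t : ℂ) (hτ : 0 < τ.im) (hp : 0 < p.im) (h : OmegaDefined a t τ p)
    {r q x y : ℂ} (hr : r = Complex.exp (2 * Real.pi * I * p))
    (hq : q = Complex.exp (2 * Real.pi * I * τ))
    (hx : x = Complex.exp (2 * Real.pi * I * (t - a)))
    (hy : y = Complex.exp (2 * Real.pi * I * (t + a))) :
    dprod r q y ≠ 0 ∧ dprod r q (r * (q * x⁻¹)) ≠ 0 ∧
    OmegaFn a t τ p = dprod r q x * dprod r q (r * (q * y⁻¹)) /
      (dprod r q y * dprod r q (r * (q * x⁻¹))) := by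
  have hr1 : ‖r‖ < 1 := hr ▸ norm_exp_lt hp
  have hq1 : ‖q‖ < 1 := hq ▸ norm_exp_lt hτ
  have key : ∀ (j k : ℕ) (z : ℂ), r ^ (j + 1) * q ^ (k + 1) * z = r ^ j * q ^ k * (r * (q * z)) := by
    intros; ring
  unfold OmegaDefined at h
  unfold OmegaFn
  simp only [Complex.exp_neg, ← hr, ← hq, ← hx, ← hy, key] at h ⊢
  have n1 : dprod r q y ≠ 0 := dprod_ne hr1 hq1 _ fun j k => (h j k).1
  have n2 : dprod r q (r * (q * x⁻¹)) ≠ 0 := dprod_ne hr1 hq1 _ fun j k => (h j k).2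
  refine ⟨n1, n2, ?_⟩
  have hnum := (hasProd_dprod hr1 hq1 x).mul (hasProd_dprod hr1 hq1 (r * (q * y⁻¹)))
  have hden := (hasProd_dprod hr1 hq1 y).mul (hasProd_dprod hr1 hq1 (r * (q * x⁻¹)))
  refine HasProd.tprod_eq ?_
  have := Filter.Tendsto.div hnum hden (mul_ne_zero n1 n2)
  refine Filter.Tendsto.congr (fun s => ?_) this
  simp only [Pi.div_apply]
  exact (Finset.prod_div_distrib _ _).symm

lemma theta_eq (τ : ℂ) (hτ : 0 < τ.im) : ∃ C : ℂ, ∀ t : ℂ, jacobiTheta1 t τ =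
    C * Complex.exp (-(Real.pi * I * t)) *
      ((∏' k : ℕ, (1 - Complex.exp (2 * Real.pi * I * τ) ^ k * Complex.exp (2 * Real.pi * I * t))) *
      ∏' k : ℕ, (1 - Complex.exp (2 * Real.pi * I * τ) ^ k *
        (Complex.exp (2 * Real.pi * I * τ) * (Complex.exp (2 * Real.pi * I * t))⁻¹))) := by
  obtain ⟨L, hL0, hL⟩ := qfac_tendsto (norm_exp_lt hτ)
  refine ⟨-(L * Complex.exp (Real.pi * I * τ / 4 - Real.pi * I / 2)), fun t => ?_⟩
  let T : ℤ → ℂ := fun m => Complex.exp (Real.pi * I * (m - 1 / 2) ^ 2 * τ +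
    2 * Real.pi * I * (m - 1 / 2) * (t + 1 / 2))
  have hs : Summable T := by
    have := ((summable_jacobiTheta₂_term_iff (t + 1 / 2 - τ / 2) τ).mpr hτ).mul_left
      (Complex.exp (Real.pi * I * τ / 4 - Real.pi * I * (t + 1 / 2)))
    refine this.congr fun m => ?_
    simp only [jacobiTheta₂_term, T]
    rw [← Complex.exp_add]
    congr 1
    ring
  have hT : ∀ m, T (m + 1) = -(Complex.exp (2 * Real.pi * I * τ) ^ m *
      Complex.exp (2 * Real.pi * I * t) * T m) := by
    intro m
    rw [neg_eq_neg_one_mul, ← Complex.exp_pi_mul_I, ← Complex.exp_int_mul]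
    simp only [T]
    rw [← Complex.exp_add, ← Complex.exp_add, ← Complex.exp_add]
    congr 1
    push_cast
    ring
  have h1 : ∑' m, T m = ∑' j : ℤ, Complex.exp (Real.pi * I * (j + 1/2) ^ 2 * τ +
      2 * Real.pi * I * (j + 1/2) * (t + 1/2)) := by
    rw [← (Equiv.addRight (1 : ℤ)).tsum_eq]
    refine tsum_congr fun j => ?_
    simp only [T, Equiv.coe_addRight]
    congr 1
    push_cast
    ring
  have hj := jtp (Complex.exp_ne_zero _) (norm_exp_lt hτ) (Complex.exp_ne_zero _) hL0 hL T hT hs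
  have h0 : T 0 = Complex.exp (Real.pi * I * τ / 4 - Real.pi * I / 2) *
      Complex.exp (-(Real.pi * I * t)) := by
    simp only [T]
    rw [← Complex.exp_add]
    congr 1
    push_cast
    ring
  rw [jacobiTheta1, ← h1, hj, h0]
  ring

/-- `Φ_a(t) = e^{−2πiat/p} Ω_a(t)` is a phase function:
`Φ_a(t+p) = (θ(t+a,τ)/θ(t−a,τ)) Φ_a(t)` wherever both products are defined and
`θ(t−a,τ) ≠ 0`. -/
theorem phase_function_property (τ p a t : ℂ) (hτ : 0 < τ.im) (hp : 0 < p.im)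
    (hdef : OmegaDefined a t τ p) (hdef' : OmegaDefined a (t + p) τ p)
    (hθ : jacobiTheta1 (t - a) τ ≠ 0) :
    Complex.exp (-(2 * Real.pi * I * a * (t + p)) / p) * OmegaFn a (t + p) τ p =
      (jacobiTheta1 (t + a) τ / jacobiTheta1 (t - a) τ) *
        (Complex.exp (-(2 * Real.pi * I * a * t) / p) * OmegaFn a t τ p) := by
  obtain ⟨C, hC⟩ := theta_eq τ hτ
  rw [hC] at hθ
  rw [hC (t + a), hC (t - a)]
  have hr1 := norm_exp_lt hp
  have hq1 := norm_exp_lt hτ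
  obtain ⟨n1, n2, e1⟩ := omega_eq τ p a t hτ hp hdef rfl rfl rfl rfl
  obtain ⟨n3, n4, e2⟩ := omega_eq τ p a (t + p) hτ hp hdef' rfl rfl
    (x := Complex.exp (2 * Real.pi * I * p) * Complex.exp (2 * Real.pi * I * (t - a)))
    (y := Complex.exp (2 * Real.pi * I * p) * Complex.exp (2 * Real.pi * I * (t + a)))
    (by rw [← Complex.exp_add]; congr 1; ring) (by rw [← Complex.exp_add]; congr 1; ring)
  rw [e1, e2]
  have hp0 : p ≠ 0 := by rintro rfl; simp at hp
  have hE1 : Complex.exp (-(2 * Real.pi * I * a * (t + p)) / p) =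
      Complex.exp (-(2 * Real.pi * I * a * t) / p) * Complex.exp (-(2 * Real.pi * I * a)) := by
    rw [← Complex.exp_add]; congr 1; field_simp; ring
  have hE2 : Complex.exp (-(Real.pi * I * (t + a))) =
      Complex.exp (-(Real.pi * I * (t - a))) * Complex.exp (-(2 * Real.pi * I * a)) := by
    rw [← Complex.exp_add]; congr 1; ring
  rw [hE1, hE2]
  have hr0 : Complex.exp (2 * Real.pi * I * p) ≠ 0 := Complex.exp_ne_zero _
  have hx0 : Complex.exp (2 * Real.pi * I * (t - a)) ≠ 0 := Complex.exp_ne_zero _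
  have hy0 : Complex.exp (2 * Real.pi * I * (t + a)) ≠ 0 := Complex.exp_ne_zero _
  generalize Complex.exp (2 * Real.pi * I * p) = r at *
  generalize Complex.exp (2 * Real.pi * I * τ) = q at *
  generalize Complex.exp (2 * Real.pi * I * (t - a)) = x at *
  generalize Complex.exp (2 * Real.pi * I * (t + a)) = y at *
  have c : ∀ z : ℂ, r * (q * (r * z)⁻¹) = q * z⁻¹ := by
    intro z; rw [mul_inv]; field_simp
  rw [c] at n4
  rw [c, c]
  rw [dprod_step hr1 hq1 y] at n1
  rw [dprod_step hr1 hq1 (q * x⁻¹)] at n4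
  rw [dprod_step hr1 hq1 x, dprod_step hr1 hq1 y, dprod_step hr1 hq1 (q * x⁻¹),
    dprod_step hr1 hq1 (q * y⁻¹)]
  have m1 := left_ne_zero_of_mul n1
  have m2 := left_ne_zero_of_mul n4
  have m3 := left_ne_zero_of_mul (left_ne_zero_of_mul hθ)
  have m4 := right_ne_zero_of_mul (left_ne_zero_of_mul hθ)
  have m5 := left_ne_zero_of_mul (right_ne_zero_of_mul hθ)
  generalize (∏' k : ℕ, (1 - q ^ k * x)) = Px at *
  generalize (∏' k : ℕ, (1 - q ^ k * y)) = Py at *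
  generalize (∏' k : ℕ, (1 - q ^ k * (q * x⁻¹))) = Qx at *
  generalize (∏' k : ℕ, (1 - q ^ k * (q * y⁻¹))) = Qy at *
  generalize dprod r q (r * x) = d1 at *
  generalize dprod r q (r * y) = d2 at *
  generalize dprod r q (r * (q * x⁻¹)) = d3 at *
  generalize dprod r q (r * (q * y⁻¹)) = d4 at *
  generalize Complex.exp (-(Real.pi * I * (t - a))) = E1 at *
  field_simp
end

section
/- Let τ ∈ ℂ with Im τ > 0, η ∈ ℂ, n = n' + n'' and m = m' + m'' nonnegative integers, a₁,…,aₙ ∈ ℂ, z₁,…,zₙ ∈ ℂ, λ ∈ ℂ, and set ν = a₁ + … + a_{n'} − 2ηm'. Suppose f(t₁,…,t_{m'}) lies in F^{m'}_{a₁,…,a_{n'}}(z₁,…,z_{n'}, λ) and g(t₁,…,t_{m''}) lies in F^{m''}_{a_{n'+1},…,aₙ}(z_{n'+1},…,zₙ, λ−2ν). Then the function k(t₁,…,t_m) = (1/(m'! m''!)) Sym( f(t₁,…,t_{m'}) g(t_{m'+1},…,t_m) ∏_{m'<j≤m, 1≤l≤n'} θ(t_j − z_l + a_l)/θ(t_j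 − z_l − a_l) ) is well defined and lies in F^m_{a₁,…,aₙ}(z₁,…,zₙ, λ). -/
open Complex Finset

/-- The theta factors in the numerators/denominators of the space `F^m_a(z,λ)`
are nonvanishing at `t` (the regular locus of its elements). -/
def regLoc (τ η : ℂ) {n m : ℕ} (a z : Fin n → ℂ) (t : Fin m → ℂ) : Prop :=
  (∀ i j : Fin m, i ≠ j → jacobiTheta1 (t i - t j) τ ≠ 0) ∧
  (∀ i j : Fin m, i ≠ j → jacobiTheta1 (t i - t j + 2 * η) τ ≠ 0) ∧
  (∀ (i : Fin m) (k : Fin n), jacobiTheta1 (t i - z k - a k) τ ≠ 0)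

/-- Membership in the space `F^m_{a₁,…,aₙ}(z₁,…,zₙ,λ)` of symmetric functions:
(i) `∏_{i<j}θ(t_i−t_j+2η)·∏_{i,k}θ(t_i−z_k−a_k)·f` extends holomorphically to
`ℂ^m` (and `f` is holomorphic on the regular locus); (ii) `f` is 1-periodic in
each `t_j` and quasiperiodic with multiplier `e^{−2πi(λ+4ηj−2η)}` under
`t_j → t_j+τ`; (iii) `f` is invariant under the twisted `S_m`-action. -/
def memF (τ η lam : ℂ) (n m : ℕ) (a z : Fin n → ℂ) (f : (Fin m → ℂ) → ℂ) : Prop :=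
  (∀ t : Fin m → ℂ, regLoc τ η a z t → AnalyticAt ℂ f t) ∧
  (∃ g : (Fin m → ℂ) → ℂ, (∀ t, AnalyticAt ℂ g t) ∧
    ∀ t : Fin m → ℂ, regLoc τ η a z t →
      g t = (∏ i : Fin m, ∏ j : Fin m,
              if i < j then jacobiTheta1 (t i - t j + 2 * η) τ else 1) *
        (∏ i : Fin m, ∏ k : Fin n, jacobiTheta1 (t i - z k - a k) τ) * f t) ∧
  (∀ (t : Fin m → ℂ) (j : Fin m), regLoc τ η a z t →
      regLoc τ η a z (Function.update t j (t j + 1)) →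
      f (Function.update t j (t j + 1)) = f t) ∧
  (∀ (t : Fin m → ℂ) (j : Fin m), regLoc τ η a z t →
      regLoc τ η a z (Function.update t j (t j + τ)) →
      f (Function.update t j (t j + τ)) =
        Complex.exp (-(2 * Real.pi * I * (lam + 4 * η * (((j : ℕ) : ℂ) + 1) - 2 * η))) * f t) ∧
  (∀ (t : Fin m → ℂ) (j j' : Fin m), (j : ℕ) + 1 = (j' : ℕ) →
      regLoc τ η a z t → regLoc τ η a z (t ∘ Equiv.swap j j') →
      f (t ∘ Equiv.swap j j') *
        (jacobiTheta1 (t j - t j' - 2 * η) τ / jacobiTheta1 (t j - t j' + 2 * η) τ) = f t)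

open scoped Classical in
/-- The twisted action of a permutation `s ∈ S_m` on functions of `(t₁,…,t_m)`,
extending the action of the transpositions `(j,j+1)`:
`f ↦ f(…,t_{j+1},t_j,…)·θ(t_j−t_{j+1}−2η)/θ(t_j−t_{j+1}+2η)`. -/
noncomputable def symAct (τ η : ℂ) {m : ℕ} (s : Equiv.Perm (Fin m))
    (f : (Fin m → ℂ) → ℂ) (t : Fin m → ℂ) : ℂ :=
  f (t ∘ s) *
    ∏ q : Fin m × Fin m,
      if q.1 < q.2 ∧ s.symm q.2 < s.symm q.1 then
        jacobiTheta1 (t q.1 - t q.2 - 2 * η) τ / jacobiTheta1 (t q.1 - t q.2 + 2 * η) τ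
      else 1

/-- The symmetrization operator `Sym = ∑_{s ∈ S_m} s` for the twisted action. -/
noncomputable def symOp (τ η : ℂ) {m : ℕ} (f : (Fin m → ℂ) → ℂ)
    (t : Fin m → ℂ) : ℂ :=
  ∑ s : Equiv.Perm (Fin m), symAct τ η s f t

section helpers


theorem exp_add_pi' (x : ℂ) : Complex.exp (x + ((Real.pi : ℂ) * I)) = -Complex.exp x := by
  rw [Complex.exp_add, Complex.exp_pi_mul_I]; ring

theorem comp_analytic {m m₁ : ℕ} (e : Fin m₁ → Fin m) (t : Fin m → ℂ) :
    AnalyticAt ℂ (fun t : Fin m → ℂ => t ∘ e) t := by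
  rw [analyticAt_pi_iff]
  intro i
  exact (ContinuousLinearMap.proj (R := ℂ) (φ := fun _ : Fin m => ℂ) (e i)).analyticAt t

theorem coord_analytic {m : ℕ} (i : Fin m) (t : Fin m → ℂ) :
    AnalyticAt ℂ (fun t : Fin m → ℂ => t i) t :=
  (ContinuousLinearMap.proj (R := ℂ) (φ := fun _ : Fin m => ℂ) i).analyticAt t

theorem th_eq (t τ : ℂ) : jacobiTheta1 t τ =
    -(Complex.exp (((Real.pi : ℂ) * I) * (τ / 4 + t + 1 / 2)) * jacobiTheta₂ (t + 1 / 2 + τ / 2) τ) := by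
  unfold jacobiTheta1 jacobiTheta₂
  rw [← tsum_mul_left]
  congr 1
  refine tsum_congr fun j => ?_
  unfold jacobiTheta₂_term
  rw [← Complex.exp_add]
  congr 1
  ring

theorem th_analytic (τ : ℂ) (hτ : 0 < τ.im) (x : ℂ) :
    AnalyticAt ℂ (fun t => jacobiTheta1 t τ) x := by
  have : Differentiable ℂ (fun t => jacobiTheta1 t τ) := by
    intro t
    simp_rw [th_eq]
    have h := (differentiableAt_jacobiTheta₂_fst (t + 1 / 2 + τ / 2) hτ)
    have h2 : DifferentiableAt ℂ (fun t : ℂ => jacobiTheta₂ (t + 1 / 2 + τ / 2) τ) t :=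
      DifferentiableAt.comp (g := fun z => jacobiTheta₂ z τ) (f := fun t : ℂ => t + 1 / 2 + τ / 2)
        t h (by fun_prop)
    fun_prop
  exact this.analyticAt x

theorem th_analytic_comp {τ : ℂ} (hτ : 0 < τ.im) {m : ℕ} {φ : (Fin m → ℂ) → ℂ} {t : Fin m → ℂ}
    (h : AnalyticAt ℂ φ t) : AnalyticAt ℂ (fun t => jacobiTheta1 (φ t) τ) t :=
  AnalyticAt.comp (g := fun x => jacobiTheta1 x τ) (th_analytic τ hτ _) h

theorem th_add_one (t τ : ℂ) : jacobiTheta1 (t + 1) τ = -jacobiTheta1 t τ := by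
  rw [th_eq, th_eq, show t + 1 + 1 / 2 + τ / 2 = (t + 1 / 2 + τ / 2) + 1 by ring,
    jacobiTheta₂_add_left,
    show ((Real.pi : ℂ) * I) * (τ / 4 + (t + 1) + 1 / 2) = ((Real.pi : ℂ) * I) * (τ / 4 + t + 1 / 2) + ((Real.pi : ℂ) * I) by ring,
    Complex.exp_add, Complex.exp_pi_mul_I]
  ring

theorem th_add_tau (t τ : ℂ) : jacobiTheta1 (t + τ) τ =
    -(Complex.exp (-((Real.pi : ℂ) * I) * (τ + 2 * t)) * jacobiTheta1 t τ) := by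
  rw [th_eq, th_eq, show t + τ + 1 / 2 + τ / 2 = (t + 1 / 2 + τ / 2) + τ by ring,
    jacobiTheta₂_add_left']
  have h1 : Complex.exp (((Real.pi : ℂ) * I) * (τ / 4 + (t + τ) + 1 / 2)) *
      Complex.exp (-((Real.pi : ℂ) * I) * (τ + 2 * (t + 1 / 2 + τ / 2))) =
      - (Complex.exp (-((Real.pi : ℂ) * I) * (τ + 2 * t)) * Complex.exp (((Real.pi : ℂ) * I) * (τ / 4 + t + 1 / 2))) := by
    rw [← Complex.exp_add, ← Complex.exp_add, ← exp_add_pi', Complex.exp_eq_exp_iff_exists_int]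
    exact ⟨-1, by push_cast; ring⟩
  simp only [neg_mul] at h1 ⊢
  linear_combination (-jacobiTheta₂ (t + 1 / 2 + τ / 2) τ) * h1

theorem th_neg (t τ : ℂ) : jacobiTheta1 (-t) τ = -jacobiTheta1 t τ := by
  rw [th_eq, th_eq, show -t + 1 / 2 + τ / 2 = -(t - 1 / 2 - τ / 2) by ring,
    jacobiTheta₂_neg_left, ← jacobiTheta₂_add_left,
    show t + 1 / 2 + τ / 2 = (t - 1 / 2 - τ / 2 + 1) + τ by ring, jacobiTheta₂_add_left']
  have h1 : Complex.exp (((Real.pi : ℂ) * I) * (τ / 4 + t + 1 / 2)) *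
      Complex.exp (-((Real.pi : ℂ) * I) * (τ + 2 * (t - 1 / 2 - τ / 2 + 1))) =
      - Complex.exp (((Real.pi : ℂ) * I) * (τ / 4 + -t + 1 / 2)) := by
    rw [← Complex.exp_add, ← exp_add_pi', Complex.exp_eq_exp_iff_exists_int]
    exact ⟨-1, by push_cast; ring⟩
  simp only [neg_mul] at h1 ⊢
  linear_combination (-jacobiTheta₂ (t - 1 / 2 - τ / 2 + 1) τ) * h1

theorem rat_add_one (x a τ : ℂ) :
    jacobiTheta1 (x + 1 + a) τ / jacobiTheta1 (x + 1 - a) τ =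
      jacobiTheta1 (x + a) τ / jacobiTheta1 (x - a) τ := by
  rw [show x + 1 + a = x + a + 1 by ring, show x + 1 - a = x - a + 1 by ring,
    th_add_one, th_add_one, neg_div_neg_eq]

theorem rat_add_tau (x a τ : ℂ) :
    jacobiTheta1 (x + τ + a) τ / jacobiTheta1 (x + τ - a) τ =
      Complex.exp (-(4 * ((Real.pi : ℂ) * I) * a)) * (jacobiTheta1 (x + a) τ / jacobiTheta1 (x - a) τ) := by
  rw [show x + τ + a = x + a + τ by ring, show x + τ - a = x - a + τ by ring,
    th_add_tau, th_add_tau, neg_div_neg_eq,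
    show Complex.exp (-(4 * ((Real.pi : ℂ) * I) * a)) = Complex.exp (-((Real.pi : ℂ) * I) * (τ + 2 * (x + a))) /
      Complex.exp (-((Real.pi : ℂ) * I) * (τ + 2 * (x - a))) by rw [← Complex.exp_sub]; congr 1; ring]
  rw [mul_div_mul_comm]

theorem rat_sub_one (x a τ : ℂ) :
    jacobiTheta1 (x - 1 + a) τ / jacobiTheta1 (x - 1 - a) τ =
      jacobiTheta1 (x + a) τ / jacobiTheta1 (x - a) τ := by
  rw [← rat_add_one (x - 1)]; ring_nf

theorem rat_sub_tau (x a τ : ℂ) :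
    jacobiTheta1 (x - τ + a) τ / jacobiTheta1 (x - τ - a) τ =
      Complex.exp (4 * ((Real.pi : ℂ) * I) * a) * (jacobiTheta1 (x + a) τ / jacobiTheta1 (x - a) τ) := by
  have h := rat_add_tau (x - τ) a τ
  rw [sub_add_cancel] at h
  rw [h, ← mul_assoc, ← Complex.exp_add]; simp

/-- inversion indicator product -/
noncomputable def Rs (τ η : ℂ) {m : ℕ} (s : Equiv.Perm (Fin m)) (t : Fin m → ℂ) : ℂ :=
  ∏ q : Fin m × Fin m,
      if q.1 < q.2 ∧ s.symm q.2 < s.symm q.1 then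
        jacobiTheta1 (t q.1 - t q.2 - 2 * η) τ / jacobiTheta1 (t q.1 - t q.2 + 2 * η) τ
      else 1

theorem symAct_eq (τ η : ℂ) {m : ℕ} (s : Equiv.Perm (Fin m))
    (f : (Fin m → ℂ) → ℂ) (t : Fin m → ℂ) : symAct τ η s f t = f (t ∘ s) * Rs τ η s t := by
  unfold symAct Rs
  congr!

theorem regLoc_comp {τ η : ℂ} {n m : ℕ} {a z : Fin n → ℂ} {t : Fin m → ℂ}
    (h : regLoc τ η a z t) {m₁ n₁ : ℕ} (e : Fin m₁ → Fin m) (he : Function.Injective e)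
    (c : Fin n₁ → Fin n) :
    regLoc τ η (a ∘ c) (z ∘ c) (t ∘ e) :=
  ⟨fun i j hij => h.1 _ _ (fun h' => hij (he h')), fun i j hij => h.2.1 _ _ (fun h' => hij (he h')),
    fun i k => h.2.2 _ _⟩

theorem regLoc_perm {τ η : ℂ} {n m : ℕ} {a z : Fin n → ℂ} {t : Fin m → ℂ}
    (h : regLoc τ η a z t) (s : Equiv.Perm (Fin m)) : regLoc τ η a z (t ∘ s) :=
  regLoc_comp h s s.injective id

theorem Rs_analytic {τ η : ℂ} (hτ : 0 < τ.im) {n m : ℕ} {a z : Fin n → ℂ} {t : Fin m → ℂ}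
    (h : regLoc τ η a z t) (s : Equiv.Perm (Fin m)) : AnalyticAt ℂ (Rs τ η s) t := by
  unfold Rs
  refine Finset.analyticAt_fun_prod _ fun q _ => ?_
  split_ifs with hq
  · refine AnalyticAt.div ?_ ?_ (h.2.1 _ _ hq.1.ne)
    · exact th_analytic_comp hτ
        (((coord_analytic _ _).sub (coord_analytic _ _)).sub analyticAt_const)
    · exact th_analytic_comp hτ
        (((coord_analytic _ _).sub (coord_analytic _ _)).add analyticAt_const)
  · exact analyticAt_const

theorem Rs_add_one (τ η : ℂ) {m : ℕ} (s : Equiv.Perm (Fin m)) (t : Fin m → ℂ) (j : Fin m) :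
    Rs τ η s (Function.update t j (t j + 1)) = Rs τ η s t := by
  unfold Rs
  refine Finset.prod_congr rfl fun q _ => ?_
  split_ifs with hq
  · have hne := hq.1.ne
    rcases q with ⟨x, y⟩
    simp only [Function.update_apply] at *
    have e1 := rat_add_one (t x - t y) (-(2*η)) τ
    have e2 := rat_sub_one (t x - t y) (-(2*η)) τ
    simp only [sub_neg_eq_add, ← sub_eq_add_neg] at e1 e2
    by_cases h1 : x = j
    · subst h1
      rw [if_pos rfl, if_neg (Ne.symm hne), ← e1, show t x + 1 - t y = t x - t y + 1 by ring]
    · by_cases h2 : y = j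
      · subst h2
        rw [if_pos rfl, if_neg h1, ← e2, show t x - (t y + 1) = t x - t y - 1 by ring]
      · rw [if_neg h1, if_neg h2]
  · rfl

theorem inv_count {m : ℕ} (s : Equiv.Perm (Fin m)) (j : Fin m) :
    (∑ q : Fin m × Fin m, if q.1 < q.2 ∧ s.symm q.2 < s.symm q.1 then
      ((if q.1 = j then 1 else 0) - (if q.2 = j then 1 else 0) : ℤ) else 0) =
      ((s.symm j : ℕ) : ℤ) - ((j : ℕ) : ℤ) := by
  have cnt : ∀ k : Fin m, (∑ b : Fin m, if b < k then (1 : ℤ) else 0) = ((k : ℕ) : ℤ) := by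
    intro k
    rw [← Finset.sum_filter]
    simp [Finset.filter_gt_eq_Iio]
  have h1 : (∑ q : Fin m × Fin m, if q.1 < q.2 ∧ s.symm q.2 < s.symm q.1 then
      ((if q.1 = j then 1 else 0) - (if q.2 = j then 1 else 0) : ℤ) else 0) =
      (∑ b : Fin m, if j < b ∧ s.symm b < s.symm j then (1 : ℤ) else 0) -
      (∑ b : Fin m, if b < j ∧ s.symm j < s.symm b then (1 : ℤ) else 0) := by
    have h2 : ∀ q : Fin m × Fin m, (if q.1 < q.2 ∧ s.symm q.2 < s.symm q.1 then
      ((if q.1 = j then 1 else 0) - (if q.2 = j then 1 else 0) : ℤ) else 0) =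
      (if q.1 = j then (if q.1 < q.2 ∧ s.symm q.2 < s.symm q.1 then 1 else 0) else 0) -
      (if q.2 = j then (if q.1 < q.2 ∧ s.symm q.2 < s.symm q.1 then 1 else 0) else 0) := by
      intro q; split_ifs <;> simp
    simp_rw [h2]
    rw [Finset.sum_sub_distrib]
    congr 1
    · rw [Fintype.sum_prod_type, Finset.sum_comm]
      simp
    · rw [Fintype.sum_prod_type]
      simp
  rw [h1, ← Finset.sum_sub_distrib, ← cnt j, ← cnt (s.symm j),
    ← Equiv.sum_comp s.symm (fun b => if b < s.symm j then (1 : ℤ) else 0),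
    ← Finset.sum_sub_distrib]
  refine Finset.sum_congr rfl fun b _ => ?_
  rcases lt_trichotomy b j with h | h | h
  · rcases lt_trichotomy (s.symm b) (s.symm j) with h' | h' | h'
    · simp [h, h', h.not_gt, h'.not_gt]
    · exact absurd (s.symm.injective h') h.ne
    · simp [h, h', h.not_gt, h'.not_gt]
  · simp [h]
  · rcases lt_trichotomy (s.symm b) (s.symm j) with h' | h' | h'
    · simp [h, h', h.not_gt, h'.not_gt]
    · exact absurd (s.symm.injective h') h.ne'
    · simp [h, h', h.not_gt, h'.not_gt]

theorem Rs_add_tau (τ η : ℂ) {m : ℕ} (s : Equiv.Perm (Fin m)) (t : Fin m → ℂ) (j : Fin m) :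
    Rs τ η s (Function.update t j (t j + τ)) =
      Complex.exp (8 * ((Real.pi : ℂ) * I) * η * (((s.symm j : ℕ) : ℂ) - ((j : ℕ) : ℂ))) * Rs τ η s t := by
  have hc : (((s.symm j : ℕ) : ℂ) - ((j : ℕ) : ℂ)) =
      ((((s.symm j : ℕ) : ℤ) - ((j : ℕ) : ℤ) : ℤ) : ℂ) := by push_cast; rfl
  rw [hc, ← inv_count s j]
  unfold Rs
  rw [Int.cast_sum, Finset.mul_sum, Complex.exp_sum, ← Finset.prod_mul_distrib]
  refine Finset.prod_congr rfl fun q _ => ?_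
  split_ifs with hq h1 h2 h2
  · exact absurd (h1.trans h2.symm) hq.1.ne
  all_goals try simp only [Function.update_apply]
  · have e1 := rat_add_tau (t q.1 - t q.2) (-(2*η)) τ
    simp only [sub_neg_eq_add, ← sub_eq_add_neg] at e1
    rw [if_pos h1, if_neg h2, ← h1, show t q.1 + τ - t q.2 = t q.1 - t q.2 + τ by ring, e1]
    congr 2; push_cast; ring
  · have e1 := rat_sub_tau (t q.1 - t q.2) (-(2*η)) τ
    simp only [sub_neg_eq_add, ← sub_eq_add_neg] at e1
    rw [if_pos h2, if_neg h1, ← h2, show t q.1 - (t q.2 + τ) = t q.1 - t q.2 - τ by ring, e1]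
    congr 2; push_cast; ring
  · simp [h1, h2]
  · simp

theorem rr_one {τ η : ℂ} {x y : ℂ} (h1 : jacobiTheta1 (x - y + 2 * η) τ ≠ 0)
    (h2 : jacobiTheta1 (y - x + 2 * η) τ ≠ 0) :
    jacobiTheta1 (y - x - 2 * η) τ / jacobiTheta1 (y - x + 2 * η) τ *
    (jacobiTheta1 (x - y - 2 * η) τ / jacobiTheta1 (x - y + 2 * η) τ) = 1 := by
  rw [show x - y - 2 * η = -(y - x + 2 * η) by ring, show y - x - 2 * η = -(x - y + 2 * η) by ring,
    th_neg, th_neg]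
  field_simp

theorem swap_lt {m : ℕ} {j j' : Fin m} (hj : (j : ℕ) + 1 = (j' : ℕ)) (x y : Fin m)
    (h1 : ¬ (x = j ∧ y = j')) (h2 : ¬ (x = j' ∧ y = j)) :
    Equiv.swap j j' x < Equiv.swap j j' y ↔ x < y := by
  simp only [Equiv.swap_apply_def, Fin.ext_iff, Fin.lt_def] at *
  split_ifs <;> omega

theorem Rs_swap {τ η : ℂ} {n m : ℕ} {a z : Fin n → ℂ} {t : Fin m → ℂ}
    (h : regLoc τ η a z t) (s : Equiv.Perm (Fin m)) (j j' : Fin m) (hj : (j : ℕ) + 1 = (j' : ℕ)) :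
    Rs τ η s (t ∘ Equiv.swap j j') *
      (jacobiTheta1 (t j - t j' - 2 * η) τ / jacobiTheta1 (t j - t j' + 2 * η) τ) =
      Rs τ η (Equiv.swap j j' * s) t := by
  have hjj : j < j' := by rw [Fin.lt_def]; omega
  set σ := Equiv.swap j j' with hσ
  have hR : Rs τ η s (t ∘ σ) = ∏ q : Fin m × Fin m,
      if σ q.1 < σ q.2 ∧ (σ * s).symm q.2 < (σ * s).symm q.1 then
        jacobiTheta1 (t q.1 - t q.2 - 2 * η) τ / jacobiTheta1 (t q.1 - t q.2 + 2 * η) τ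
      else 1 := by
    unfold Rs
    rw [← Equiv.prod_comp (Equiv.prodCongr σ σ)]
    refine Finset.prod_congr rfl fun q _ => ?_
    have h2 : ∀ x, σ (σ x) = x := fun x => by simp [hσ]
    have h3 : ∀ x, (σ * s).symm x = s.symm (σ x) := fun x => by
      rw [Equiv.symm_apply_eq]; simp [h2]
    simp [h2, h3]
  set r : Fin m × Fin m → ℂ := fun q =>
    jacobiTheta1 (t q.1 - t q.2 - 2 * η) τ / jacobiTheta1 (t q.1 - t q.2 + 2 * η) τ with hr
  set w := (σ * s).symm with hw
  have hrr : r (j', j) * r (j, j') = 1 := rr_one (h.2.1 _ _ hjj.ne) (h.2.1 _ _ hjj.ne')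
  have key : Rs τ η (σ * s) t * (∏ q : Fin m × Fin m, if q = (j', j) then
        (if w j < w j' then r (j', j) else 1) else 1) =
      Rs τ η s (t ∘ σ) * (∏ q : Fin m × Fin m, if q = (j, j') then
        (if w j' < w j then r (j, j') else 1) else 1) := by
    rw [hR]
    unfold Rs
    rw [← Finset.prod_mul_distrib, ← Finset.prod_mul_distrib]
    refine Finset.prod_congr rfl fun q _ => ?_
    by_cases h1 : q = (j, j')
    · subst h1
      have : (j, j') ≠ (j', j) := fun h => hjj.ne (Prod.ext_iff.1 h).1
      have e1 : σ j = j' := by simp [hσ]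
      have e2 : σ j' = j := by simp [hσ]
      simp only [← hw, e1, e2, this, hjj, hjj.not_gt, hr]
      simp
    · by_cases h2 : q = (j', j)
      · subst h2
        have e1 : σ j = j' := by simp [hσ]
        have e2 : σ j' = j := by simp [hσ]
        simp only [← hw, e1, e2, h1, hjj, hjj.not_gt, hr]
        simp
      · have h3 := swap_lt hj q.1 q.2 (fun h => h1 (Prod.ext h.1 h.2)) (fun h => h2 (Prod.ext h.1 h.2))
        rw [← hσ] at h3
        simp only [h1, h2, h3, if_false, mul_one, ← hw]
  simp only [Finset.prod_ite_eq', Finset.mem_univ, if_true] at key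
  change _ * r (j, j') = _
  have hne : w j ≠ w j' := fun h => hjj.ne (w.injective h)
  rcases lt_or_gt_of_ne hne with h1 | h1
  · rw [if_pos h1, if_neg h1.not_gt, mul_one] at key
    rw [← key, mul_assoc, hrr, mul_one]
  · rw [if_neg h1.not_gt, if_pos h1, mul_one] at key
    exact key.symm

/-- pole product -/
noncomputable def PP (τ η : ℂ) {m : ℕ} (t : Fin m → ℂ) : ℂ :=
  ∏ i : Fin m, ∏ j : Fin m, if i < j then jacobiTheta1 (t i - t j + 2 * η) τ else 1

noncomputable def eps {m : ℕ} (s : Equiv.Perm (Fin m)) : ℂ :=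
  ∏ q : Fin m × Fin m, if q.1 < q.2 ∧ s.symm q.2 < s.symm q.1 then -1 else 1

theorem prod_pairs {m : ℕ} (A : Fin m × Fin m → ℂ) (hA : ∀ i, A (i, i) = 1) :
    ∏ q, A q = ∏ q : Fin m × Fin m, if q.1 < q.2 then A q * A q.swap else 1 := by
  have h1 : ∏ q, A q = (∏ q : Fin m × Fin m, if q.1 < q.2 then A q else 1) *
      ∏ q : Fin m × Fin m, if q.2 < q.1 then A q else 1 := by
    rw [← Finset.prod_mul_distrib]
    refine Finset.prod_congr rfl fun q _ => ?_
    rcases lt_trichotomy q.1 q.2 with h | h | h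
    · simp [h, h.not_gt]
    · obtain ⟨x, y⟩ := q
      simp only at h
      subst h
      simp [hA]
    · simp [h, h.not_gt]
  rw [h1, ← Equiv.prod_comp (Equiv.prodComm (Fin m) (Fin m))
    (fun q : Fin m × Fin m => if q.2 < q.1 then A q else 1), ← Finset.prod_mul_distrib]
  refine Finset.prod_congr rfl fun q _ => ?_
  simp only [Equiv.prodComm_apply, Prod.fst_swap, Prod.snd_swap]
  by_cases hq : q.1 < q.2 <;> simp [hq]

theorem PP_Rs {τ η : ℂ} {n m : ℕ} {a z : Fin n → ℂ} {t : Fin m → ℂ}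
    (h : regLoc τ η a z t) (s : Equiv.Perm (Fin m)) :
    PP τ η t * Rs τ η s t = eps s * PP τ η (t ∘ s) := by
  have h1 : PP τ η (t ∘ s) = ∏ q : Fin m × Fin m, if s.symm q.1 < s.symm q.2 then
      jacobiTheta1 (t q.1 - t q.2 + 2 * η) τ else 1 := by
    unfold PP
    rw [← Fintype.prod_prod_type' (f := fun i j => if i < j then
      jacobiTheta1 ((t ∘ s) i - (t ∘ s) j + 2 * η) τ else 1),
      ← Equiv.prod_comp (Equiv.prodCongr s s) (fun q : Fin m × Fin m =>
        if s.symm q.1 < s.symm q.2 then jacobiTheta1 (t q.1 - t q.2 + 2 * η) τ else 1)]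
    simp
  rw [h1, prod_pairs _ (by simp)]
  unfold PP Rs eps
  rw [← Fintype.prod_prod_type' (f := fun i j => if i < j then
      jacobiTheta1 (t i - t j + 2 * η) τ else 1),
    ← Finset.prod_mul_distrib, ← Finset.prod_mul_distrib]
  refine Finset.prod_congr rfl fun q _ => ?_
  by_cases hq : q.1 < q.2
  · have hne : s.symm q.1 ≠ s.symm q.2 := fun h => hq.ne (s.symm.injective h)
    rcases lt_or_gt_of_ne hne with h1 | h1
    · simp [hq, h1, h1.not_gt]
    · simp only [hq, h1, h1.not_gt, Prod.fst_swap, Prod.snd_swap]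
      simp only [if_true, and_self, if_false, one_mul]
      rw [mul_div_cancel₀ _ (h.2.1 _ _ hq.ne),
        show t q.1 - t q.2 - 2 * η = -(t q.2 - t q.1 + 2 * η) by ring, th_neg]
      ring
  · simp [hq]

theorem memF_symOp (τ η lam c : ℂ) (hτ : 0 < τ.im) (n m : ℕ) (a z : Fin n → ℂ)
    (H : (Fin m → ℂ) → ℂ)
    (hA : ∀ t : Fin m → ℂ, regLoc τ η a z t → AnalyticAt ℂ H t)
    (hG : ∃ g : (Fin m → ℂ) → ℂ, (∀ t, AnalyticAt ℂ g t) ∧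
      ∀ t : Fin m → ℂ, regLoc τ η a z t →
        g t = PP τ η t *
          (∏ i : Fin m, ∏ k : Fin n, jacobiTheta1 (t i - z k - a k) τ) * H t)
    (h1 : ∀ (t : Fin m → ℂ) (j : Fin m), regLoc τ η a z t →
      regLoc τ η a z (Function.update t j (t j + 1)) →
      H (Function.update t j (t j + 1)) = H t)
    (h2 : ∀ (t : Fin m → ℂ) (j : Fin m), regLoc τ η a z t →
      regLoc τ η a z (Function.update t j (t j + τ)) →
      H (Function.update t j (t j + τ)) =
        Complex.exp (-(2 * Real.pi * I * (lam + 4 * η * (((j : ℕ) : ℂ) + 1) - 2 * η))) * H t) :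
    memF τ η lam n m a z (fun t => c * symOp τ η H t) := by
  have hupd : ∀ (t : Fin m → ℂ) (j : Fin m) (x : ℂ) (s : Equiv.Perm (Fin m)),
      Function.update t j (t j + x) ∘ s =
        Function.update (t ∘ s) (s.symm j) ((t ∘ s) (s.symm j) + x) := by
    intro t j x s
    rw [Function.update_comp_equiv]
    simp
  have hlin : ∀ s : Equiv.Perm (Fin m), ∀ t : Fin m → ℂ,
      AnalyticAt ℂ (fun t : Fin m → ℂ => t ∘ s) t := by
    intro s t
    exact comp_analytic s t
  refine ⟨?_, ?_, ?_, ?_, ?_⟩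
  · intro t ht
    refine analyticAt_const.mul ?_
    unfold symOp
    simp_rw [symAct_eq]
    refine Finset.analyticAt_fun_sum _ fun s _ => ?_
    refine AnalyticAt.mul ?_ (Rs_analytic hτ ht s)
    exact AnalyticAt.comp (g := H) (hA _ (regLoc_perm ht s)) (hlin s t)
  · obtain ⟨G, hGa, hGe⟩ := hG
    refine ⟨fun t => c * ∑ s : Equiv.Perm (Fin m), eps s * G (t ∘ s), ?_, ?_⟩
    · intro t
      refine analyticAt_const.mul ?_
      refine Finset.analyticAt_fun_sum _ fun s _ => ?_
      exact analyticAt_const.mul (AnalyticAt.comp (g := G) (hGa _) (hlin s t))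
    · intro t ht
      change _ = PP τ η t * _ * _
      unfold symOp
      simp only
      rw [mul_left_comm (PP τ η t * _)]
      congr 1
      rw [Finset.mul_sum]
      refine Finset.sum_congr rfl fun s _ => ?_
      rw [symAct_eq, hGe _ (regLoc_perm ht s)]
      have hQ : (∏ i : Fin m, ∏ k : Fin n, jacobiTheta1 ((t ∘ s) i - z k - a k) τ) =
          ∏ i : Fin m, ∏ k : Fin n, jacobiTheta1 (t i - z k - a k) τ :=
        Equiv.prod_comp s (fun i => ∏ k : Fin n, jacobiTheta1 (t i - z k - a k) τ)
      rw [hQ]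
      have := PP_Rs ht s
      linear_combination (-(∏ i : Fin m, ∏ k : Fin n, jacobiTheta1 (t i - z k - a k) τ) *
        H (t ∘ s)) * this
  · intro t j ht ht'
    simp only [symOp, symAct_eq]
    congr 1
    refine Finset.sum_congr rfl fun s _ => ?_
    have hr := regLoc_perm ht' s
    rw [hupd] at hr
    rw [Rs_add_one, hupd, h1 _ _ (regLoc_perm ht s) hr]
  · intro t j ht ht'
    simp only [symOp, symAct_eq]
    rw [mul_left_comm]
    congr 1
    rw [Finset.mul_sum]
    refine Finset.sum_congr rfl fun s _ => ?_
    have hr := regLoc_perm ht' s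
    rw [hupd] at hr
    rw [Rs_add_tau, hupd, h2 _ _ (regLoc_perm ht s) hr]
    rw [mul_mul_mul_comm, ← Complex.exp_add]
    congr 2
    ring
  · intro t j j' hj ht ht'
    simp only [symOp, symAct_eq]
    rw [mul_assoc, Finset.sum_mul]
    congr 1
    rw [← Equiv.sum_comp (Equiv.mulLeft (Equiv.swap j j'))
      (fun s : Equiv.Perm (Fin m) => H (t ∘ s) * Rs τ η s t)]
    refine Finset.sum_congr rfl fun s _ => ?_
    rw [mul_assoc, Rs_swap ht s j j' hj]
    rfl

theorem PP_split (τ η : ℂ) {m' m'' : ℕ} (u : Fin (m' + m'') → ℂ) :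
    PP τ η u = PP τ η (u ∘ Fin.castAdd m'') * PP τ η (u ∘ Fin.natAdd m') *
      ∏ i : Fin m', ∏ j : Fin m'',
        jacobiTheta1 (u (Fin.castAdd m'' i) - u (Fin.natAdd m' j) + 2 * η) τ := by
  have e1 : ∀ (i : Fin m') (j : Fin m''), Fin.castAdd m'' i < Fin.natAdd m' j := by
    intro i j; rw [Fin.lt_def]; simp only [Fin.val_castAdd, Fin.val_natAdd]; omega
  have e2 : ∀ (i : Fin m') (j : Fin m''), ¬ Fin.natAdd m' j < Fin.castAdd m'' i :=
    fun i j => (e1 i j).not_gt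
  have e3 : ∀ (i j : Fin m'), Fin.castAdd m'' i < Fin.castAdd m'' j ↔ i < j := fun i j => Iff.rfl
  have e4 : ∀ (i j : Fin m''), Fin.natAdd m' i < Fin.natAdd m' j ↔ i < j := by
    intro i j; rw [Fin.lt_def, Fin.lt_def]; simp only [Fin.val_natAdd]; omega
  unfold PP
  rw [Fin.prod_univ_add]
  simp only [Fin.prod_univ_add, e1, e2, e3, e4, if_true, if_false, Finset.prod_const_one, one_mul,
    Finset.prod_mul_distrib, Function.comp_apply]
  ring

theorem upd_cast_cast {m' m'' : ℕ} (u : Fin (m' + m'') → ℂ) (p : Fin m') (x : ℂ) :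
    (fun i => Function.update u (Fin.castAdd m'' p) x (Fin.castAdd m'' i)) =
      Function.update (fun i => u (Fin.castAdd m'' i)) p x := by
  ext i
  simp [Function.update_apply]

theorem upd_cast_nat {m' m'' : ℕ} (u : Fin (m' + m'') → ℂ) (p : Fin m') (x : ℂ) (i : Fin m'') :
    Function.update u (Fin.castAdd m'' p) x (Fin.natAdd m' i) = u (Fin.natAdd m' i) := by
  rw [Function.update_of_ne]
  rw [Ne, Fin.ext_iff]; simp only [Fin.val_castAdd, Fin.val_natAdd]; omega

theorem upd_nat_cast {m' m'' : ℕ} (u : Fin (m' + m'') → ℂ) (p : Fin m'') (x : ℂ) (i : Fin m') :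
    Function.update u (Fin.natAdd m' p) x (Fin.castAdd m'' i) = u (Fin.castAdd m'' i) := by
  rw [Function.update_of_ne]
  rw [Ne, Fin.ext_iff]; simp only [Fin.val_castAdd, Fin.val_natAdd]; omega

theorem upd_nat_nat {m' m'' : ℕ} (u : Fin (m' + m'') → ℂ) (p : Fin m'') (x : ℂ) :
    (fun i => Function.update u (Fin.natAdd m' p) x (Fin.natAdd m' i)) =
      Function.update (fun i => u (Fin.natAdd m' i)) p x := by
  ext i
  simp [Function.update_apply]

end helpers

/-- **Tensor product of spaces of symmetric theta functions** (Proposition 3.2):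
for `f ∈ F^{m'}_{a₁,…,a_{n'}}(z₁,…,z_{n'},λ)` and
`g ∈ F^{m''}_{a_{n'+1},…,aₙ}(z_{n'+1},…,zₙ,λ−2ν)`, `ν = a₁+⋯+a_{n'}−2ηm'`, the
function `k = (1/(m'!m''!)) Sym(f(t₁,…,t_{m'}) g(t_{m'+1},…,t_m)
∏_{m'<j≤m,1≤l≤n'} θ(t_j−z_l+a_l)/θ(t_j−z_l−a_l))` lies in
`F^m_{a₁,…,aₙ}(z₁,…,zₙ,λ)`. -/
theorem tensor_product_of_symmetric_function_spaces
    (τ η lam : ℂ) (hτ : 0 < τ.im) (n' n'' m' m'' : ℕ)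
    (a z : Fin (n' + n'') → ℂ)
    (f : (Fin m' → ℂ) → ℂ) (g : (Fin m'' → ℂ) → ℂ)
    (hf : memF τ η lam n' m' (a ∘ Fin.castAdd n'') (z ∘ Fin.castAdd n'') f)
    (hg : memF τ η
      (lam - 2 * ((∑ l : Fin n', a (Fin.castAdd n'' l)) - 2 * η * (m' : ℂ)))
      n'' m'' (a ∘ Fin.natAdd n') (z ∘ Fin.natAdd n') g) :
    memF τ η lam (n' + n'') (m' + m'') a z
      (fun t => (1 / ((m'.factorial : ℂ) * (m''.factorial : ℂ))) *
        symOp τ η (fun t' =>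
          f (fun i => t' (Fin.castAdd m'' i)) *
          g (fun i => t' (Fin.natAdd m' i)) *
          ∏ j : Fin m'', ∏ l : Fin n',
            jacobiTheta1 (t' (Fin.natAdd m' j) - z (Fin.castAdd n'' l) +
                a (Fin.castAdd n'' l)) τ /
              jacobiTheta1 (t' (Fin.natAdd m' j) - z (Fin.castAdd n'' l) -
                a (Fin.castAdd n'' l)) τ) t) := by
  have hreg1 : ∀ t : Fin (m' + m'') → ℂ, regLoc τ η a z t →
      regLoc τ η (a ∘ Fin.castAdd n'') (z ∘ Fin.castAdd n'') (fun i => t (Fin.castAdd m'' i)) :=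
    fun t ht => regLoc_comp ht _ (Fin.castAdd_injective m' m'') _
  have hreg2 : ∀ t : Fin (m' + m'') → ℂ, regLoc τ η a z t →
      regLoc τ η (a ∘ Fin.natAdd n') (z ∘ Fin.natAdd n') (fun i => t (Fin.natAdd m' i)) :=
    fun t ht => regLoc_comp ht _ (Fin.natAdd_injective m'' m') _
  obtain ⟨hf1, ⟨Gf, hGf, hGf'⟩, hf3, hf4, -⟩ := hf
  obtain ⟨hg1, ⟨Gg, hGg, hGg'⟩, hg3, hg4, -⟩ := hg
  apply memF_symOp τ η lam _ hτ
  · intro t ht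
    refine AnalyticAt.mul (AnalyticAt.mul ?_ ?_) ?_
    · exact AnalyticAt.comp (g := f) (hf1 _ (hreg1 t ht)) (comp_analytic (Fin.castAdd m'') t)
    · exact AnalyticAt.comp (g := g) (hg1 _ (hreg2 t ht)) (comp_analytic (Fin.natAdd m') t)
    · refine Finset.analyticAt_fun_prod _ fun j _ => Finset.analyticAt_fun_prod _ fun l _ => ?_
      refine AnalyticAt.div ?_ ?_ (ht.2.2 _ _)
      · exact th_analytic_comp hτ
          (((coord_analytic _ _).sub analyticAt_const).add analyticAt_const)
      · exact th_analytic_comp hτ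
          (((coord_analytic _ _).sub analyticAt_const).sub analyticAt_const)
  · refine ⟨fun u => Gf (u ∘ Fin.castAdd m'') * Gg (u ∘ Fin.natAdd m') *
      (∏ i : Fin m', ∏ j : Fin m'',
        jacobiTheta1 (u (Fin.castAdd m'' i) - u (Fin.natAdd m' j) + 2 * η) τ) *
      (∏ i : Fin m', ∏ k : Fin n'', jacobiTheta1 (u (Fin.castAdd m'' i) - z (Fin.natAdd n' k)
        - a (Fin.natAdd n' k)) τ) *
      (∏ j : Fin m'', ∏ l : Fin n', jacobiTheta1 (u (Fin.natAdd m' j) - z (Fin.castAdd n'' l)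
        + a (Fin.castAdd n'' l)) τ), ?_, ?_⟩
    · intro u
      refine ((((AnalyticAt.comp (g := Gf) (hGf _) (comp_analytic (Fin.castAdd m'') u)).mul
        (AnalyticAt.comp (g := Gg) (hGg _) (comp_analytic (Fin.natAdd m') u))).mul ?_).mul
        ?_).mul ?_
      · refine Finset.analyticAt_fun_prod _ fun j _ => Finset.analyticAt_fun_prod _ fun l _ => ?_
        exact th_analytic_comp hτ
          (((coord_analytic _ _).sub (coord_analytic _ _)).add analyticAt_const)
      · refine Finset.analyticAt_fun_prod _ fun j _ => Finset.analyticAt_fun_prod _ fun l _ => ?_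
        exact th_analytic_comp hτ
          (((coord_analytic _ _).sub analyticAt_const).sub analyticAt_const)
      · refine Finset.analyticAt_fun_prod _ fun j _ => Finset.analyticAt_fun_prod _ fun l _ => ?_
        exact th_analytic_comp hτ
          (((coord_analytic _ _).sub analyticAt_const).add analyticAt_const)
    · intro u hu
      have e1 := hGf' _ (hreg1 u hu)
      have e2 := hGg' _ (hreg2 u hu)
      change Gf (u ∘ Fin.castAdd m'') = PP τ η (u ∘ Fin.castAdd m'') * _ * _ at e1
      change Gg (u ∘ Fin.natAdd m') = PP τ η (u ∘ Fin.natAdd m') * _ * _ at e2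
      simp only
      rw [PP_split, e1, e2, Fin.prod_univ_add]
      simp only [Fin.prod_univ_add, Finset.prod_mul_distrib, Finset.prod_div_distrib,
        Function.comp_apply]
      have hne : (∏ j : Fin m'', ∏ l : Fin n', jacobiTheta1 (u (Fin.natAdd m' j) -
          z (Fin.castAdd n'' l) - a (Fin.castAdd n'' l)) τ) ≠ 0 :=
        Finset.prod_ne_zero_iff.2 fun j _ => Finset.prod_ne_zero_iff.2 fun l _ => hu.2.2 _ _
      field_simp
  · intro t p ht ht'
    have r1 := hreg1 _ ht
    have r2 := hreg2 _ ht
    have r1' := hreg1 _ ht'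
    have r2' := hreg2 _ ht'
    revert ht ht' r1 r2 r1' r2'
    refine Fin.addCases (fun i => ?_) (fun i => ?_) p
    · intro ht ht' r1 r2 r1' r2'
      simp only [upd_cast_nat]
      rw [upd_cast_cast] at r1' ⊢
      rw [hf3 _ i r1 r1']
    · intro ht ht' r1 r2 r1' r2'
      simp only [upd_nat_cast]
      rw [upd_nat_nat] at r2' ⊢
      rw [hg3 _ i r2 r2']
      congr 1
      refine Finset.prod_congr rfl fun j _ => Finset.prod_congr rfl fun l _ => ?_
      by_cases hj : j = i
      · subst hj
        rw [Function.update_self, add_sub_right_comm, rat_add_one]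
      · rw [Function.update_of_ne (fun h => hj (Fin.natAdd_injective _ _ h))]
  · intro t p ht ht'
    have r1 := hreg1 _ ht
    have r2 := hreg2 _ ht
    have r1' := hreg1 _ ht'
    have r2' := hreg2 _ ht'
    revert ht ht' r1 r2 r1' r2'
    refine Fin.addCases (fun i => ?_) (fun i => ?_) p
    · intro ht ht' r1 r2 r1' r2'
      simp only [upd_cast_nat]
      rw [upd_cast_cast] at r1' ⊢
      rw [hf4 _ i r1 r1', Fin.val_castAdd]
      ring
    · intro ht ht' r1 r2 r1' r2'
      simp only [upd_nat_cast]
      rw [upd_nat_nat] at r2' ⊢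
      rw [hg4 _ i r2 r2']
      have key : (∏ j : Fin m'', ∏ l : Fin n',
            jacobiTheta1 (Function.update t (Fin.natAdd m' i) (t (Fin.natAdd m' i) + τ)
                (Fin.natAdd m' j) - z (Fin.castAdd n'' l) + a (Fin.castAdd n'' l)) τ /
              jacobiTheta1 (Function.update t (Fin.natAdd m' i) (t (Fin.natAdd m' i) + τ)
                (Fin.natAdd m' j) - z (Fin.castAdd n'' l) - a (Fin.castAdd n'' l)) τ) =
          Complex.exp (-(4 * ((Real.pi : ℂ) * I) * ∑ l : Fin n', a (Fin.castAdd n'' l))) *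
          ∏ j : Fin m'', ∏ l : Fin n',
            jacobiTheta1 (t (Fin.natAdd m' j) - z (Fin.castAdd n'' l) +
                a (Fin.castAdd n'' l)) τ /
              jacobiTheta1 (t (Fin.natAdd m' j) - z (Fin.castAdd n'' l) -
                a (Fin.castAdd n'' l)) τ := by
        have hE : Complex.exp (-(4 * ((Real.pi : ℂ) * I) * ∑ l : Fin n', a (Fin.castAdd n'' l))) =
            ∏ j : Fin m'', if j = i then
              ∏ l : Fin n', Complex.exp (-(4 * ((Real.pi : ℂ) * I) * a (Fin.castAdd n'' l)))
              else 1 := by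
          rw [Finset.prod_ite_eq' Finset.univ i, if_pos (Finset.mem_univ i), ← Complex.exp_sum,
            Finset.mul_sum, Finset.sum_neg_distrib]
        rw [hE, ← Finset.prod_mul_distrib]
        refine Finset.prod_congr rfl fun j _ => ?_
        by_cases hj : j = i
        · subst hj
          rw [if_pos rfl, ← Finset.prod_mul_distrib]
          refine Finset.prod_congr rfl fun l _ => ?_
          rw [Function.update_self, add_sub_right_comm, rat_add_tau]
        · rw [if_neg hj, one_mul, Function.update_of_ne (fun h => hj (Fin.natAdd_injective _ _ h))]
      rw [key, Fin.val_natAdd]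
      have hexp : Complex.exp (-(2 * Real.pi * I * (lam + 4 * η *
            (((m' + (i : ℕ) : ℕ) : ℂ) + 1) - 2 * η))) =
          Complex.exp (-(2 * Real.pi * I * (lam - 2 * ((∑ l : Fin n', a (Fin.castAdd n'' l)) -
            2 * η * (m' : ℂ)) + 4 * η * (((i : ℕ) : ℂ) + 1) - 2 * η))) *
          Complex.exp (-(4 * ((Real.pi : ℂ) * I) * ∑ l : Fin n', a (Fin.castAdd n'' l))) := by
        rw [← Complex.exp_add]
        congr 1
        push_cast
        ring
      rw [hexp]
      ring
end
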